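/- arXiv:2103.14668 — 2 statements merged into one kernel-verified Lean document; each statement's English description precedes it below -/
import Mathlib

section
/- Let K: R -> [0,infty) be bounded, supported on [-1,1], with \int_R K(u) du = 1; set K_{h,t}(s) := h^{-1}K((s-t)/h). Let w, g: R -> R be bounded and continuously differentiable with bounded derivatives. Define f_h(r,s) := \int_R h K_{h,t}(s) K_{h,t}(r) w(t) dt and K^{(2)} := \int_0^2 ( \int_{-1}^1 K(u+v) K(u) du )^2 dv. Then sup_{s in R} | (1/h) \int_s^{s+2h} f_h(r,s)^2 g(r) dr - K^{(2)} w(s)^2 g(s) | -> 0 as h -> 0+. -/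
open MeasureTheory Filter

/-- Rescaled kernel `K_{h,t}(s) = h⁻¹ K((s-t)/h)`. -/
noncomputable def kh (K : ℝ → ℝ) (h t s : ℝ) : ℝ := (1 / h) * K ((s - t) / h)

/-- `f_h(r,s) = ∫_ℝ h K_{h,t}(s) K_{h,t}(r) w(t) dt`. -/
noncomputable def fh (K w : ℝ → ℝ) (h r s : ℝ) : ℝ :=
  ∫ t, h * kh K h t s * kh K h t r * w t

/-- `K⁽²⁾ = ∫₀² (∫₋₁¹ K(u+v)K(u) du)² dv`. -/
noncomputable def K2 (K : ℝ → ℝ) : ℝ :=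
  ∫ v in (0:ℝ)..2, (∫ u in (-1:ℝ)..1, K (u + v) * K u) ^ 2

/-- Substituting `t = s - h u` in `fh`. -/
lemma fh_add_mul (K w : ℝ → ℝ) {h : ℝ} (hh : 0 < h) (s v : ℝ) :
    fh K w h (s + h * v) s = ∫ u, K u * K (u + v) * w (s - h * u) := by
  have h0 : h ≠ 0 := hh.ne'
  unfold fh kh
  rw [← integral_sub_left_eq_self _ volume s]
  have key := Measure.integral_comp_mul_left (fun x : ℝ => h * (1 / h * K ((s - (s - x)) / h)) *
    (1 / h * K ((s + h * v - (s - x)) / h)) * w (s - x)) h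
  rw [abs_of_pos (inv_pos.2 hh), smul_eq_mul, eq_inv_mul_iff_mul_eq₀ h0,
    ← integral_const_mul] at key
  rw [← key]
  congr 1 with u
  have h1 : (s - (s - h * u)) / h = u := by field_simp; ring
  have h2 : (s + h * v - (s - h * u)) / h = u + v := by field_simp; ring
  rw [h1, h2]
  field_simp

lemma integrable_mul_shift_mul {K φ : ℝ → ℝ} {C B : ℝ} (hKmeas : Measurable K)
    (hK0 : ∀ u, 0 ≤ K u) (hKb : ∀ u, K u ≤ C) (hK : Integrable K) (hφ : Measurable φ)
    (hφb : ∀ u, |φ u| ≤ B) (v : ℝ) : Integrable (fun u => K u * K (u + v) * φ u) := by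
  refine (hK.mul_const (C * B)).mono' (by fun_prop) (.of_forall fun u => ?_)
  rw [Real.norm_eq_abs, abs_mul, abs_mul, abs_of_nonneg (hK0 u), abs_of_nonneg (hK0 _), mul_assoc]
  exact mul_le_mul_of_nonneg_left (mul_le_mul (hKb _) (hφb u) (abs_nonneg _)
    ((hK0 _).trans (hKb u))) (hK0 u)

lemma abs_integral_mul_shift_mul_le {K φ : ℝ → ℝ} {C B : ℝ}
    (hK0 : ∀ u, 0 ≤ K u) (hKb : ∀ u, K u ≤ C)
    (hKsupp : Function.support K ⊆ Set.Icc (-1 : ℝ) 1) (hK1 : ∫ u, K u = 1)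
    (hφb : ∀ u ∈ Set.Icc (-1 : ℝ) 1, |φ u| ≤ B) (v : ℝ) :
    |∫ u, K u * K (u + v) * φ u| ≤ C * B := by
  have hK : Integrable K := .of_integral_ne_zero (by simp [hK1])
  have := norm_integral_le_of_norm_le (f := fun u => K u * K (u + v) * φ u)
    (hK.mul_const (C * B)) (.of_forall fun u => ?_)
  · rwa [integral_mul_const, hK1, one_mul] at this
  by_cases hu : K u = 0
  · simp [hu]
  rw [Real.norm_eq_abs, abs_mul, abs_mul, abs_of_nonneg (hK0 u), abs_of_nonneg (hK0 _), mul_assoc]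
  exact mul_le_mul_of_nonneg_left (mul_le_mul (hKb _) (hφb u (hKsupp hu)) (abs_nonneg _)
    ((hK0 _).trans (hKb u))) (hK0 u)

lemma measurable_integral_mul_shift_mul {K φ : ℝ → ℝ} (hKmeas : Measurable K)
    (hφ : Measurable φ) : Measurable fun v => ∫ u, K u * K (u + v) * φ u := by
  have : StronglyMeasurable fun p : ℝ × ℝ => K p.2 * K (p.2 + p.1) * φ p.2 :=
    Measurable.stronglyMeasurable (by fun_prop)
  exact this.integral_prod_right'.measurable

lemma K2_eq_integral {K : ℝ → ℝ} (hKsupp : Function.support K ⊆ Set.Icc (-1 : ℝ) 1) :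
    K2 K = ∫ v in (0 : ℝ)..2, (∫ u, K u * K (u + v) * 1) ^ 2 := by
  unfold K2
  congr 1 with v
  rw [intervalIntegral.integral_of_le (by norm_num), ← integral_Icc_eq_integral_Ioc,
    setIntegral_eq_integral_of_forall_compl_eq_zero]
  · simp only [mul_one, mul_comm]
  · intro u hu
    rw [Function.notMem_support.1 fun h => hu (hKsupp h), mul_zero]

lemma abs_sub_le_of_abs_deriv_le {f : ℝ → ℝ} {B : ℝ} (hf : ContDiff ℝ 1 f)
    (hB : ∀ x, |deriv f x| ≤ B) (x y : ℝ) : |f y - f x| ≤ B * |y - x| :=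
  Convex.norm_image_sub_le_of_norm_deriv_le (s := Set.univ)
    (fun x _ => (hf.differentiable (by norm_num)).differentiableAt) (fun x _ => hB x)
    convex_univ trivial trivial

lemma intervalIntegrable_of_measurable_of_abs_le {f : ℝ → ℝ} {C : ℝ} (hf : Measurable f)
    (hC : ∀ x, |f x| ≤ C) (a b : ℝ) : IntervalIntegrable f volume a b :=
  (intervalIntegrable_const (c := C)).mono_fun hf.aestronglyMeasurable
    (.of_forall fun x => (hC x).trans (le_abs_self C))

lemma abs_sq_mul_sub_sq_mul_le {a b c d M D G E : ℝ} (ha : |a| ≤ M) (hb : |b| ≤ M)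
    (hab : |a - b| ≤ D) (hc : |c| ≤ G) (hcd : |c - d| ≤ E) :
    |a ^ 2 * c - b ^ 2 * d| ≤ 2 * M * D * G + M ^ 2 * E := by
  have hM : 0 ≤ M := (abs_nonneg a).trans ha
  have hD : 0 ≤ D := (abs_nonneg _).trans hab
  calc |a ^ 2 * c - b ^ 2 * d| = |(a + b) * (a - b) * c + b ^ 2 * (c - d)| := by ring_nf
    _ ≤ |a + b| * |a - b| * |c| + |b| ^ 2 * |c - d| := by
      refine (abs_add_le _ _).trans_eq ?_
      simp only [abs_mul, abs_pow]
    _ ≤ 2 * M * D * G + M ^ 2 * E := by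
      have : |a + b| ≤ 2 * M := (abs_add_le a b).trans (by linarith)
      gcongr

lemma abs_scaled_integral_sub_le {K w g : ℝ → ℝ} {C Bw Bg Dw Dg : ℝ} (hKmeas : Measurable K)
    (hK0 : ∀ u, 0 ≤ K u) (hKb : ∀ u, K u ≤ C)
    (hKsupp : Function.support K ⊆ Set.Icc (-1 : ℝ) 1) (hK1 : ∫ u, K u = 1)
    (hw : ContDiff ℝ 1 w) (hg : ContDiff ℝ 1 g)
    (hwb : ∀ x, |w x| ≤ Bw) (hgb : ∀ x, |g x| ≤ Bg)
    (hwd : ∀ x, |deriv w x| ≤ Dw) (hgd : ∀ x, |deriv g x| ≤ Dg) {h : ℝ} (hh : 0 < h) (s : ℝ) :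
    |(1 / h) * (∫ r in s..(s + 2 * h), fh K w h r s ^ 2 * g r) - K2 K * w s ^ 2 * g s| ≤
      (2 * (C * Bw) * (C * (Dw * h)) * Bg + (C * Bw) ^ 2 * (Dg * (2 * h))) * 2 := by
  have hK : Integrable K := .of_integral_ne_zero (by simp [hK1])
  have hwm : Measurable w := hw.continuous.measurable
  have hgm : Measurable g := hg.continuous.measurable
  have hDw : 0 ≤ Dw := (abs_nonneg _).trans (hwd 0)
  have hDg : 0 ≤ Dg := (abs_nonneg _).trans (hgd 0)
  set F : ℝ → ℝ := fun v => ∫ u, K u * K (u + v) * w (s - h * u) with hF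
  set κ : ℝ → ℝ := fun v => ∫ u, K u * K (u + v) * 1 with hκ
  have hκw (v : ℝ) : κ v * w s = ∫ u, K u * K (u + v) * w s := by
    simp only [hκ, mul_one, integral_mul_const]
  have hFm : Measurable F := measurable_integral_mul_shift_mul hKmeas (by fun_prop)
  have hκm : Measurable κ := measurable_integral_mul_shift_mul hKmeas measurable_const
  have hFb (v : ℝ) : |F v| ≤ C * Bw :=
    abs_integral_mul_shift_mul_le hK0 hKb hKsupp hK1 (fun u _ => hwb _) v
  have hκb (v : ℝ) : |κ v * w s| ≤ C * Bw := by
    rw [hκw]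
    exact abs_integral_mul_shift_mul_le (φ := fun _ => w s) hK0 hKb hKsupp hK1 (fun u _ => hwb s) v
  have hFκ (v : ℝ) : |F v - κ v * w s| ≤ C * (Dw * h) := by
    rw [hκw, hF, ← integral_sub
      (integrable_mul_shift_mul hKmeas hK0 hKb hK (by fun_prop) (fun u => hwb _) v)
      (integrable_mul_shift_mul (φ := fun _ => w s) hKmeas hK0 hKb hK measurable_const
        (fun u => hwb s) v)]
    simp only [← mul_sub]
    refine abs_integral_mul_shift_mul_le (φ := fun u => w (s - h * u) - w s)
      hK0 hKb hKsupp hK1 (fun u hu => ?_) v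
    refine (abs_sub_le_of_abs_deriv_le hw hwd _ _).trans ?_
    rw [sub_sub_cancel_left, abs_neg, abs_mul, abs_of_pos hh]
    exact mul_le_mul_of_nonneg_left (mul_le_of_le_one_right hh.le (abs_le.2 hu)) hDw
  have hsubst : (1 / h) * (∫ r in s..(s + 2 * h), fh K w h r s ^ 2 * g r) =
      ∫ v in (0 : ℝ)..2, F v ^ 2 * g (s + h * v) := by
    have := intervalIntegral.smul_integral_comp_add_mul (a := 0) (b := 2)
      (fun r => fh K w h r s ^ 2 * g r) h s
    rw [mul_zero, add_zero, mul_comm h 2] at this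
    rw [← this, smul_eq_mul, ← mul_assoc, one_div_mul_cancel hh.ne', one_mul]
    simp only [fh_add_mul K w hh, hF]
  have hlim : K2 K * w s ^ 2 * g s = ∫ v in (0 : ℝ)..2, (κ v * w s) ^ 2 * g s := by
    simp only [K2_eq_integral hKsupp, mul_pow, intervalIntegral.integral_mul_const, hκ]
  have hint {f e : ℝ → ℝ} (hf : Measurable f) (he : Measurable e) (hfb : ∀ v, |f v| ≤ C * Bw)
      (heb : ∀ v, |e v| ≤ Bg) : IntervalIntegrable (fun v => f v ^ 2 * e v) volume 0 2 := by
    refine intervalIntegrable_of_measurable_of_abs_le (C := (C * Bw) ^ 2 * Bg)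
      (by fun_prop) (fun v => ?_) 0 2
    rw [abs_mul, abs_pow]
    have := hfb v
    have := heb v
    gcongr
  rw [hsubst, hlim, ← intervalIntegral.integral_sub
    (hint hFm (e := fun v => g (s + h * v)) (by fun_prop) hFb fun _ => hgb _)
    (hint (f := fun v => κ v * w s) (e := fun _ => g s) (by fun_prop) measurable_const hκb
      fun _ => hgb s)]
  suffices hpt : ∀ v ∈ Set.uIoc (0 : ℝ) 2, ‖F v ^ 2 * g (s + h * v) - (κ v * w s) ^ 2 * g s‖ ≤
      2 * (C * Bw) * (C * (Dw * h)) * Bg + (C * Bw) ^ 2 * (Dg * (2 * h)) by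
    simpa using intervalIntegral.norm_integral_le_of_norm_le_const hpt
  intro v hv
  rw [Set.uIoc_of_le zero_le_two] at hv
  refine abs_sq_mul_sub_sq_mul_le (hFb v) (hκb v) (hFκ v) (hgb _)
    ((abs_sub_le_of_abs_deriv_le hg hgd _ _).trans ?_)
  rw [add_sub_cancel_left, abs_of_nonneg (mul_nonneg hh.le hv.1.le), mul_comm 2 h]
  have := hv.2
  gcongr

/-- Deterministic kernel-approximation limit underlying Lemma `phi_convergence`:
`sup_s |h⁻¹ ∫_s^{s+2h} f_h(r,s)² g(r) dr - K⁽²⁾ w(s)² g(s)| → 0` as `h → 0⁺`. -/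
theorem stmt_15 (K : ℝ → ℝ) (hKmeas : Measurable K) (hK0 : ∀ u, 0 ≤ K u)
    (CK : ℝ) (hKb : ∀ u, K u ≤ CK)
    (hKsupp : Function.support K ⊆ Set.Icc (-1:ℝ) 1) (hK1 : ∫ u, K u = 1)
    (w g : ℝ → ℝ) (hw : ContDiff ℝ 1 w) (hg : ContDiff ℝ 1 g)
    (hwb : ∃ B, ∀ x, |w x| ≤ B) (hgb : ∃ B, ∀ x, |g x| ≤ B)
    (hwd : ∃ B, ∀ x, |deriv w x| ≤ B) (hgd : ∃ B, ∀ x, |deriv g x| ≤ B) :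
    Tendsto (fun h : ℝ => ⨆ s : ℝ,
        |(1 / h) * (∫ r in s..(s + 2 * h), fh K w h r s ^ 2 * g r) - K2 K * w s ^ 2 * g s|)
      (nhdsWithin 0 (Set.Ioi 0)) (nhds 0) := by
  obtain ⟨Bw, hwb⟩ := hwb
  obtain ⟨Bg, hgb⟩ := hgb
  obtain ⟨Dw, hwd⟩ := hwd
  obtain ⟨Dg, hgd⟩ := hgd
  have hlim : Tendsto (fun h : ℝ => (2 * (CK * Bw) * (CK * (Dw * h)) * Bg +
      (CK * Bw) ^ 2 * (Dg * (2 * h))) * 2) (nhdsWithin 0 (Set.Ioi 0)) (nhds 0) := by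
    refine Tendsto.mono_left ?_ nhdsWithin_le_nhds
    exact Continuous.tendsto' (by fun_prop) _ _ (by simp)
  refine squeeze_zero' (.of_forall fun h => Real.iSup_nonneg fun s => abs_nonneg _) ?_ hlim
  filter_upwards [self_mem_nhdsWithin] with h hh
  exact ciSup_le fun s => abs_scaled_integral_sub_le hKmeas hK0 hKb hKsupp hK1 hw hg
    hwb hgb hwd hgd hh s
end

section
/- Let E be a finite set, m>0, F>0, M>=0. Let d: E x E -> [0,infty] be a function, and for e in E and A a subset of E define d(e,A) := inf_{a in A} d(e,a), with d(e,emptyset) := infinity. Let psi: E -> [0,M] and chi, chibar: E -> {0,1} with chi(e) <= chibar(e) for all e. For A a subset of E define Kappa(A) := sup_{a in A} sum_{e in E} 1(d(e,a) < m) * chibar(e) (with Kappa(emptyset) := 0), and let H(A) in {0,1} satisfy H(A) >= 1(Kappa(A) >= F). Then for all subsets I, J of E with I contained in J, and any subset E' of E: sum_{e in E'} psi(e) chi(e) | 1(d(e,I) >= m) - 1(d(e,J) >= m) | <= M * |J \ I| * ( F + H(J \ I) * Kappa(E) ). -/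
open scoped Classical ENNReal

noncomputable section

/-- Distance from a point to a set, `d(e,∅) = ∞`. -/
def dSet {E : Type} (d : E → E → ℝ≥0∞) (e : E) (A : Set E) : ℝ≥0∞ := ⨅ a ∈ A, d e a

/-- `Kappa(A) = sup_{a ∈ A} ∑_e 1(d(e,a) < m) χbar(e)` (with `Kappa(∅) = 0`). -/
def Kap {E : Type} [Fintype E] (d : E → E → ℝ≥0∞) (χb : E → ℝ) (m : ℝ≥0∞) (A : Set E) : ℝ :=
  ⨆ a ∈ A, ∑ e : E, (if d e a < m then (1:ℝ) else 0) * χb e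

theorem le_dSet_iff {E : Type} {d : E → E → ℝ≥0∞} {m : ℝ≥0∞} {e : E} {A : Set E} :
    m ≤ dSet d e A ↔ ∀ a ∈ A, m ≤ d e a :=
  le_iInf₂_iff

/-- The number of `χb`-active elements near `a ∈ A` is at most `Kap A`. -/
theorem sum_le_Kap {E : Type} [Fintype E] (d : E → E → ℝ≥0∞) {χb : E → ℝ} (m : ℝ≥0∞)
    {A : Set E} {a : E} (ha : a ∈ A) :
    ∑ e : E, (if d e a < m then (1 : ℝ) else 0) * χb e ≤ Kap d χb m A := by
  refine le_trans ?_ (le_ciSup (Set.finite_range _).bddAbove a)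
  rw [ciSup_pos ha]

/-- Enlarging `I` to `J` changes the indicator of distance at least `m` by at most the number of
elements of `J \ I` at distance less than `m`. -/
theorem abs_indicator_dSet_sub_le {E : Type} [Fintype E] (d : E → E → ℝ≥0∞) (m : ℝ≥0∞) (e : E)
    {I J : Set E} (hIJ : I ⊆ J) :
    |(if m ≤ dSet d e I then (1 : ℝ) else 0) - (if m ≤ dSet d e J then (1 : ℝ) else 0)|
      ≤ ∑ a ∈ (J \ I).toFinset, (if d e a < m then (1 : ℝ) else 0) := by
  have hnn : ∀ a ∈ (J \ I).toFinset, (0 : ℝ) ≤ if d e a < m then (1 : ℝ) else 0 := by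
    intro a _
    split_ifs <;> norm_num
  by_cases hJ : m ≤ dSet d e J
  · have hI : m ≤ dSet d e I := le_dSet_iff.2 fun a ha => le_dSet_iff.1 hJ a (hIJ ha)
    simp [hI, hJ]
  by_cases hI : m ≤ dSet d e I
  · obtain ⟨a, haJ, ha⟩ : ∃ a ∈ J, d e a < m := by
      simpa [le_dSet_iff] using hJ
    have haI : a ∉ I := fun h => (le_dSet_iff.1 hI a h).not_gt ha
    simpa only [hI, hJ, ha, if_true, if_false, sub_zero, abs_one] using
      Finset.single_le_sum hnn (Set.mem_toFinset.2 ⟨haJ, haI⟩)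
  · simp [hI, hJ]

/-- The core combinatorial hub-size estimate from the proof of Lemma `phi_bound`. -/
theorem stmt_16 {E : Type} [Fintype E] (m : ℝ≥0∞) (hm : 0 < m) (F M : ℝ)
    (hF : 0 < F) (hM : 0 ≤ M)
    (d : E → E → ℝ≥0∞) (ψ χ χb : E → ℝ)
    (hψ : ∀ e, ψ e ∈ Set.Icc (0:ℝ) M)
    (hχ : ∀ e, χ e = 0 ∨ χ e = 1) (hχb : ∀ e, χb e = 0 ∨ χb e = 1)
    (hle : ∀ e, χ e ≤ χb e)
    (H : Set E → ℝ) (hH01 : ∀ A, H A = 0 ∨ H A = 1)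
    (hH : ∀ A : Set E, (if F ≤ Kap d χb m A then (1:ℝ) else 0) ≤ H A) :
    ∀ I J : Set E, I ⊆ J → ∀ E' : Finset E,
      ∑ e ∈ E', ψ e * χ e *
          |(if m ≤ dSet d e I then (1:ℝ) else 0) - (if m ≤ dSet d e J then (1:ℝ) else 0)|
        ≤ M * ((J \ I).ncard : ℝ) * (F + H (J \ I) * Kap d χb m Set.univ) := by
  intro I J hIJ E'
  have hb : ∀ e, 0 ≤ χb e := fun e => by rcases hχb e with h | h <;> simp [h]
  have hc : ∀ e, 0 ≤ χ e := fun e => by rcases hχ e with h | h <;> simp [h]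
  have hind : ∀ e a, (0 : ℝ) ≤ if d e a < m then (1 : ℝ) else 0 := by
    intro e a
    split_ifs <;> norm_num
  have hub : ∀ a ∈ (J \ I).toFinset, ∑ e : E, (if d e a < m then (1 : ℝ) else 0) * χb e
      ≤ F + H (J \ I) * Kap d χb m Set.univ := by
    intro a ha
    rcases hH01 (J \ I) with h0 | h1
    · have hlt : Kap d χb m (J \ I) < F := by
        by_contra hF'
        have := hH (J \ I)
        rw [if_pos (not_lt.1 hF'), h0] at this
        norm_num at this
      have := sum_le_Kap d (χb := χb) m (Set.mem_toFinset.1 ha)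
      rw [h0]
      linarith
    · have := sum_le_Kap d (χb := χb) m (Set.mem_univ a)
      rw [h1]
      linarith
  calc _ ≤ ∑ e ∈ E', M * ∑ a ∈ (J \ I).toFinset,
            (if d e a < m then (1 : ℝ) else 0) * χb e := by
        refine Finset.sum_le_sum fun e _ => ?_
        rw [← Finset.sum_mul, mul_comm _ (χb e), ← mul_assoc]
        exact mul_le_mul (mul_le_mul (hψ e).2 (hle e) (hc e) hM)
          (abs_indicator_dSet_sub_le d m e hIJ) (abs_nonneg _) (mul_nonneg hM (hb e))
    _ ≤ ∑ e : E, M * ∑ a ∈ (J \ I).toFinset, (if d e a < m then (1 : ℝ) else 0) * χb e :=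
        Finset.sum_le_sum_of_subset_of_nonneg (Finset.subset_univ _) fun e _ _ =>
          mul_nonneg hM (Finset.sum_nonneg fun a _ => mul_nonneg (hind e a) (hb e))
    _ = M * ∑ a ∈ (J \ I).toFinset, ∑ e : E, (if d e a < m then (1 : ℝ) else 0) * χb e := by
        rw [← Finset.mul_sum, Finset.sum_comm]
    _ ≤ M * ((J \ I).toFinset.card • (F + H (J \ I) * Kap d χb m Set.univ)) :=
        mul_le_mul_of_nonneg_left (Finset.sum_le_card_nsmul _ _ _ hub) hM
    _ = _ := by
        rw [nsmul_eq_mul, Set.ncard_eq_toFinset_card', mul_assoc]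
end
end
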